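/- arXiv:2307.12081 — 5 statements merged into one kernel-verified Lean document; each statement's English description precedes it below -/
import Mathlib

section
/- Let T = (V, A, s0, s*) be a temporal planning task and T# = (V#, A#, s0#, s*) its effect-safe task. If P# is a solution for T#, then the base plan P = {(t, a) | (t, a#) ∈ P#} of P# is a solution for T. -/
open Set

/-- A durative action over atoms of type `α`:
duration, preconditions at start / as invariant / at end,
and positive/negative effects at start and end. -/
structure DAction (α : Type*) where
  dur : ℝ
  preS : Set α
  preInv : Set α
  preE : Set α
  effSp : Set α
  effSm : Set α
  effEp : Set α
  effEm : Set α

namespace DAction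

/-- Well-formedness of a durative action. -/
def WF {α : Type*} (a : DAction α) : Prop :=
  0 < a.dur ∧ a.effSm ∩ (a.effSp ∪ a.preInv) = ∅ ∧ a.effEm ∩ a.effEp = ∅

/-- All atoms of an action belong to `V`. -/
def Over {α : Type*} (a : DAction α) (V : Set α) : Prop :=
  a.preS ⊆ V ∧ a.preInv ⊆ V ∧ a.preE ⊆ V ∧
  a.effSp ⊆ V ∧ a.effSm ⊆ V ∧ a.effEp ⊆ V ∧ a.effEm ⊆ V

end DAction

/-- A scheduled effect `(t, preInv, preE, effEp, effEm)`,
recording the end time, invariant, end precondition and end effects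
of an action that has started but not yet ended. -/
abbrev Sched (α : Type*) := ℝ × Set α × Set α × Set α × Set α

/-- The scheduled effect added when action `a` starts at time `t`. -/
def schedOf {α : Type*} (t : ℝ) (a : DAction α) : Sched α :=
  (t + a.dur, a.preInv, a.preE, a.effEp, a.effEm)

/-- The tuple identifying an ending event of action `a` at time `t`. -/
def endTuple {α : Type*} (t : ℝ) (a : DAction α) : Sched α :=
  (t, a.preInv, a.preE, a.effEp, a.effEm)

/-- A time-stamped state `(t, s, E)`. -/
abbrev TState (α : Type*) := ℝ × Set α × Set (Sched α)

section Plans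

variable {α β : Type*}

/-- `P` is a (valid) plan, where the elements of `β` labelling time stamps are
interpreted as durative actions via `f`: finitely many time-stamped actions with
positive starting times and mutually disjoint starting and ending times. -/
def IsPlan (f : β → DAction α) (P : Set (ℝ × β)) : Prop :=
  P.Finite ∧ (∀ p ∈ P, 0 < p.1) ∧
  ∀ p ∈ P, ∀ q ∈ P, p ≠ q →
    p.1 ≠ q.1 ∧ p.1 + (f p.2).dur ≠ q.1 ∧
    p.1 + (f p.2).dur ≠ q.1 + (f q.2).dur

/-- Candidate time stamps for the next event after state `st`. -/
def candTimes (f : β → DAction α) (P : Set (ℝ × β)) (st : TState α) : Set ℝ :=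
  {t | ∃ b, (t, b) ∈ P ∧ st.1 < t} ∪ {t | ∃ e ∈ st.2.2, e.1 = t}

/-- One construction step of the induced sequence of time-stamped states
at position `i ≥ 1`: the new time stamp is the least candidate time, and the
state and scheduled effects are updated according to a starting or ending event. -/
def StepAt (f : β → DAction α) (P : Set (ℝ × β)) (σ : ℕ → TState α) (i : ℕ) : Prop :=
  ((σ i).1 ∈ candTimes f P (σ (i - 1)) ∧
    ∀ t ∈ candTimes f P (σ (i - 1)), (σ i).1 ≤ t) ∧
  ((∃ b, ((σ i).1, b) ∈ P ∧
      (σ i).2.1 = (f b).effSp ∪ ((σ (i - 1)).2.1 \ (f b).effSm) ∧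
      (σ i).2.2 = insert (schedOf (σ i).1 (f b)) (σ (i - 1)).2.2) ∨
   (∃ e ∈ (σ (i - 1)).2.2, e.1 = (σ i).1 ∧
      (σ i).2.1 = e.2.2.2.1 ∪ ((σ (i - 1)).2.1 \ e.2.2.2.2) ∧
      (σ i).2.2 = (σ (i - 1)).2.2 \ {e}))

/-- `σ` is the sequence of `2|P|+1` time-stamped states induced by plan `P`
with initial state `s0`. -/
def InducedSeq (f : β → DAction α) (P : Set (ℝ × β)) (s0 : Set α)
    (σ : ℕ → TState α) : Prop :=
  σ 0 = (0, s0, ∅) ∧ ∀ i, 1 ≤ i → i ≤ 2 * P.ncard → StepAt f P σ i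

/-- Consistency of a plan `P` with induced sequence `σ`: invariants of all
scheduled effects hold, and start/end preconditions hold at the
corresponding events. -/
def Consistent (f : β → DAction α) (P : Set (ℝ × β)) (σ : ℕ → TState α) : Prop :=
  ∀ i, 1 ≤ i → i ≤ 2 * P.ncard →
    (∀ e ∈ (σ i).2.2, e.2.1 ⊆ (σ i).2.1) ∧
    (∀ b, ((σ i).1, b) ∈ P → (f b).preS ⊆ (σ (i - 1)).2.1) ∧
    (∀ e ∈ (σ (i - 1)).2.2, e.1 = (σ i).1 → e.2.2.1 ⊆ (σ (i - 1)).2.1)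

end Plans

section Macro

variable {α : Type*}

/-- The macro-action `a1 ⊕ a2` of Definition 1. -/
def macroComp (a1 a2 : DAction α) : DAction α where
  dur := a1.dur + a2.dur
  preS := a1.preS ∪ (((a1.preInv ∪ a1.preE) ∩ (a1.effEm ∪ a2.effSm)) \ a1.effSp) ∪
    ((a2.preS ∩ a2.effSm) \ (a1.effSp ∪ a1.effEp))
  preInv := ((a1.preInv ∪ a1.preE) \ ((a1.effEm ∪ a2.effSm) \ a1.effSm)) ∪
    (a2.preS \ (a1.effEp ∪ (a2.effSm \ (a1.effSm ∪ a1.effEm)))) ∪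
    (a2.preInv \ (a1.effEp ∪ a2.effSp))
  preE := a2.preE \ (a1.effEp ∪ a2.effSp)
  effSp := a1.effSp \ (a1.effEm ∪ a2.effSm)
  effSm := a1.effSm ∪ (a1.effEm ∪ a2.effSm)
  effEp := a2.effEp ∪ ((a1.effEp ∪ a2.effSp) \ (a2.effSm ∪ a2.effEm))
  effEm := a2.effEm

/-- The provisos under which the composition `a1 ⊕ a2` is defined. -/
def MacroDefined (a1 a2 : DAction α) : Prop :=
  (macroComp a1 a2).effSm ∩ (macroComp a1 a2).preInv = ∅ ∧
  (a2.preE ∩ (a1.effEm ∪ a2.effSm)) \ a2.effSp = ∅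

/-- Mutex atoms: `(true, v)` represents `x(v)` and `(false, v)` represents `x(¬v)`. -/
abbrev Mux (α : Type*) := Bool × α

/-- The mutex atoms contributed by composing `a1` and `a2`,
given the mutex atoms `aux2` of `a2`. -/
def auxComp (a1 a2 : DAction α) (aux2 : Set (Mux α)) : Set (Mux α) :=
  {m | m.1 = false ∧ m.2 ∈
      ((((a1.effEp ∪ a2.effSp) \ (a2.effEp ∪ (a2.effSm ∪ a2.effEm))) ∪
        ((a1.preInv ∪ a1.preE) ∩ (a1.effEm ∪ a2.effSm)) ∪
        ((a2.preS ∩ a2.effSm) \ a1.effEp) ∪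
        ((a2.preInv ∪ a2.preE) ∩ (a1.effEp ∪ a2.effSp))) \
        (macroComp a1 a2).preInv)} ∪
  {m | m.1 = true ∧ m.2 ∈ a1.effEm ∪ a2.effSm} ∪ aux2

/-- Action terms: either an ordinary durative action, or a (right-associatively
chained) composition of two action terms into a macro-action. -/
inductive ActTerm (α : Type*) where
  | prim : DAction α → ActTerm α
  | comp : ActTerm α → ActTerm α → ActTerm α

namespace ActTerm

/-- The durative action denoted by an action term. -/
def toA : ActTerm α → DAction α
  | .prim a => a
  | .comp b1 b2 => macroComp b1.toA b2.toA

/-- The mutex atoms associated with an action term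
(`∅` for an ordinary action). -/
def aux : ActTerm α → Set (Mux α)
  | .prim _ => ∅
  | .comp b1 b2 => auxComp b1.toA b2.toA b2.aux

/-- Whether an action term is an ordinary (non-macro) action. -/
def IsPrim : ActTerm α → Prop
  | .prim _ => True
  | .comp _ _ => False

/-- Well-formedness of an action term: all constituent actions are well-formed
and every composition along the term is defined. -/
def Good : ActTerm α → Prop
  | .prim a => a.WF
  | .comp b1 b2 => b1.Good ∧ b2.Good ∧ MacroDefined b1.toA b2.toA

/-- All atoms of an action term belong to `V`. -/
def OverT (V : Set α) : ActTerm α → Prop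
  | .prim a => a.Over V
  | .comp b1 b2 => b1.OverT V ∧ b2.OverT V

end ActTerm

end Macro

section EffectSafe

variable {α : Type*}

/-- The extended atom type `V ∪ X`: original atoms plus mutex atoms. -/
abbrev ExtAtom (α : Type*) := α ⊕ Mux α

/-- The literals of `eff_s(a)`, encoded as mutex-atom indices:
`(true, v)` for `v ∈ eff_s+(a)` and `(false, v)` for `v ∈ eff_s−(a)`. -/
def litStart (a : DAction α) : Set (Mux α) :=
  {m | (m.1 = true ∧ m.2 ∈ a.effSp) ∨ (m.1 = false ∧ m.2 ∈ a.effSm)}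

/-- The literals of `eff_e(a)`, encoded as mutex-atom indices. -/
def litEnd (a : DAction α) : Set (Mux α) :=
  {m | (m.1 = true ∧ m.2 ∈ a.effEp) ∨ (m.1 = false ∧ m.2 ∈ a.effEm)}

/-- The effect-safe version `a#` of an action term `b`, over the extended atom
type, relative to the set `X` of all mutex atoms of the task (Definition 2). -/
def safeA (X : Set (Mux α)) (b : ActTerm α) : DAction (ExtAtom α) where
  dur := b.toA.dur
  preS := Sum.inl '' b.toA.preS ∪ Sum.inr ''
    (b.aux ∪ {m | m ∈ X ∧ m.1 = true ∧ (false, m.2) ∈ b.aux} ∪ (X ∩ litStart b.toA))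
  preInv := Sum.inl '' b.toA.preInv
  preE := Sum.inl '' b.toA.preE ∪ Sum.inr '' ((X \ b.aux) ∩ litEnd b.toA)
  effSp := Sum.inl '' b.toA.effSp
  effSm := Sum.inl '' b.toA.effSm ∪ Sum.inr '' b.aux
  effEp := Sum.inl '' b.toA.effEp ∪ Sum.inr '' b.aux
  effEm := Sum.inl '' b.toA.effEm

/-- The set `X` of all mutex atoms of the actions in `A`. -/
def auxOf (A : Set (ActTerm α)) : Set (Mux α) := ⋃ b ∈ A, b.aux

/-- Well-formedness of a temporal planning task `(V, A, s0, g)`. -/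
def TaskWF (V : Set α) (A : Set (ActTerm α)) (s0 g : Set α) : Prop :=
  V.Finite ∧ s0 ⊆ V ∧ g ⊆ V ∧ ∀ b ∈ A, b.Good ∧ b.OverT V

/-- `P` is a solution for the effect-safe task `T# = (V ∪ X, A#, s0 ∪ X, g)`
of the task `(V, A, s0, g)`: its actions belong to `A`, it is a valid plan of
the effect-safe actions, and its induced sequence is consistent and reaches
the goal. -/
def SafeSolution (A : Set (ActTerm α)) (s0 g : Set α)
    (P : Set (ℝ × ActTerm α)) : Prop :=
  (∀ p ∈ P, p.2 ∈ A) ∧ IsPlan (safeA (auxOf A)) P ∧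
  ∃ σ, InducedSeq (safeA (auxOf A)) P (Sum.inl '' s0 ∪ Sum.inr '' auxOf A) σ ∧
    Consistent (safeA (auxOf A)) P σ ∧
    Sum.inl '' g ⊆ (σ (2 * P.ncard)).2.1

/-- `P` is a solution for the original task with initial state `s0` and goal
`g`, interpreting action terms by the durative actions they denote. -/
def OrigSolution (s0 g : Set α) (P : Set (ℝ × ActTerm α)) : Prop :=
  IsPlan ActTerm.toA P ∧
  ∃ σ, InducedSeq ActTerm.toA P s0 σ ∧ Consistent ActTerm.toA P σ ∧
    g ⊆ (σ (2 * P.ncard)).2.1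

end EffectSafe

section Refine

variable {α β : Type*}

/-- The event time stamps of a plan `P`: `0` together with all starting and
ending times of its time-stamped actions. -/
def evTimes (f : β → DAction α) (P : Set (ℝ × β)) : Set ℝ :=
  insert 0 ({t | ∃ b, (t, b) ∈ P} ∪ {t | ∃ p ∈ P, p.1 + (f p.2).dur = t})

/-- `δ_{P}(t0, a0)` for a macro-action with first-part duration `d1` and total
duration `d`: the minimum positive difference between `t0`, `t0 + d1`, `t0 + d`
and the earlier event time stamps of `P`. -/
noncomputable def delta (f : β → DAction α) (P : Set (ℝ × β)) (t0 d1 d : ℝ) : ℝ :=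
  sInf {x | ∃ s ∈ evTimes f P,
    (x = t0 - s ∧ s < t0) ∨ (x = t0 + d1 - s ∧ s < t0 + d1) ∨
    (x = t0 + d - s ∧ s < t0 + d)}

/-- The plan obtained from `P'` by splitting the time-stamped macro-action
`(t0, b1 ⊕ b2)` into `(t1, b1)` and `(t2, b2)`. -/
def splitPlan (P' : Set (ℝ × ActTerm α)) (t0 t1 t2 : ℝ) (b1 b2 : ActTerm α) :
    Set (ℝ × ActTerm α) :=
  insert (t1, b1) (insert (t2, b2) (P' \ {(t0, ActTerm.comp b1 b2)}))

/-- The side conditions of a refinement step splitting `(t0, b1 ⊕ b2) ∈ P'`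
into `(t1, b1)` and `(t2, b2)`. -/
def SplitOk (P' : Set (ℝ × ActTerm α)) (t0 t1 t2 : ℝ) (b1 b2 : ActTerm α) : Prop :=
  (t0, ActTerm.comp b1 b2) ∈ P' ∧
  t0 - delta ActTerm.toA P' t0 b1.toA.dur (b1.toA.dur + b2.toA.dur) < t1 ∧
  t1 < t0 ∧ t1 + b1.toA.dur < t2 ∧ t2 < t0 + b1.toA.dur

/-- Refined plans of (the base plan of) `P#`, obtained by iteratively
splitting time-stamped macro-actions (Definition 3). -/
inductive Refined (Ps : Set (ℝ × ActTerm α)) : Set (ℝ × ActTerm α) → Prop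
  | base : Refined Ps Ps
  | step {P' : Set (ℝ × ActTerm α)} {t0 t1 t2 : ℝ} {b1 b2 : ActTerm α} :
      Refined Ps P' → SplitOk P' t0 t1 t2 b1 b2 →
      Refined Ps (splitPlan P' t0 t1 t2 b1 b2)

/-- `refine_P(v, (t1, t2))` relative to the induced sequence `σ` of `P`:
the least time stamp before `t1` from which the atom `v` remains true up to
(just before) `t2` without being protected against by a mutex atom `x(v)` of a
macro-action in progress, or the greatest event time stamp of `P` if no such
time stamp exists. -/
noncomputable def refineT (P : Set (ℝ × ActTerm α)) (σ : ℕ → TState α)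
    (v : α) (t1 t2 : ℝ) : ℝ :=
  sInf ({sSup (evTimes ActTerm.toA P)} ∪
    {τ | ∃ p ∈ P, τ = p.1 + p.2.toA.dur ∧ τ < t1 ∧ v ∈ p.2.toA.effEp ∧
      (∀ i ≤ 2 * P.ncard, τ ≤ (σ i).1 → (σ i).1 < t2 → v ∈ (σ i).2.1) ∧
      ¬∃ q ∈ P, (true, v) ∈ q.2.aux ∧ q.1 < t2 ∧ τ < q.1 + q.2.toA.dur} ∪
    {τ | ∃ p ∈ P, τ = p.1 ∧ τ < t1 ∧ v ∈ p.2.toA.effSp ∧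
      (∀ i ≤ 2 * P.ncard, τ ≤ (σ i).1 → (σ i).1 < t2 → v ∈ (σ i).2.1) ∧
      ¬∃ q ∈ P, (true, v) ∈ q.2.aux ∧ q.1 < t2 ∧ τ < q.1 + q.2.toA.dur} ∪
    {τ | τ = 0 ∧ (∀ i ≤ 2 * P.ncard, (σ i).1 < t2 → v ∈ (σ i).2.1) ∧
      ¬∃ q ∈ P, (true, v) ∈ q.2.aux ∧ q.1 < t2})

/-- The three `refine` bounds of the induction hypothesis in the proof of
Theorem 1: for every time-stamped action of `P`, the start, invariant and end
preconditions are established early enough and protected long enough. -/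
def RefineBounds (P : Set (ℝ × ActTerm α)) (σ : ℕ → TState α) : Prop :=
  ∀ p ∈ P,
    (∀ v ∈ p.2.toA.preS, refineT P σ v p.1 p.1 < p.1) ∧
    (∀ v ∈ p.2.toA.preInv, ∀ j, j < 2 * P.ncard → (σ j).1 = p.1 →
      refineT P σ v ((σ (j + 1)).1) (p.1 + p.2.toA.dur) ≤ p.1) ∧
    (∀ v ∈ p.2.toA.preE,
      refineT P σ v (p.1 + p.2.toA.dur) (p.1 + p.2.toA.dur) < p.1 + p.2.toA.dur)

end Refine

section Projection

variable {α β : Type*}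

/-- Restriction of a scheduled effect over the extended atoms to the original atoms. -/
def projSched (e : Sched (ExtAtom α)) : Sched α :=
  (e.1, Sum.inl ⁻¹' e.2.1, Sum.inl ⁻¹' e.2.2.1, Sum.inl ⁻¹' e.2.2.2.1, Sum.inl ⁻¹' e.2.2.2.2)

/-- Restriction of a time-stamped state over the extended atoms to the original atoms. -/
def projState (st : TState (ExtAtom α)) : TState α :=
  (st.1, Sum.inl ⁻¹' st.2.1, projSched '' st.2.2)

lemma preimage_inl_image_union (S : Set α) (T : Set β) :
    (Sum.inl ⁻¹' (Sum.inl '' S ∪ Sum.inr '' T) : Set α) = S := by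
  ext x; simp

lemma preimage_inl_image (S : Set α) :
    (Sum.inl ⁻¹' (Sum.inl '' S : Set (α ⊕ β)) : Set α) = S := by
  ext x; simp

lemma projSched_schedOf (X : Set (Mux α)) (t : ℝ) (b : ActTerm α) :
    projSched (schedOf t (safeA X b)) = schedOf t b.toA := by
  simp only [projSched, schedOf, safeA, preimage_inl_image_union, preimage_inl_image]

lemma candTimes_projState (X : Set (Mux α)) (P : Set (ℝ × ActTerm α))
    (st : TState (ExtAtom α)) :
    candTimes ActTerm.toA P (projState st) = candTimes (safeA X) P st := by
  ext t
  simp [candTimes, projState, projSched]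

lemma isPlan_toA_iff (X : Set (Mux α)) (P : Set (ℝ × ActTerm α)) :
    IsPlan ActTerm.toA P ↔ IsPlan (safeA X) P := Iff.rfl

/-- Every scheduled effect of an induced sequence stems from an action of the plan. -/
lemma InducedSeq.exists_schedOf {f : β → DAction α} {P : Set (ℝ × β)} {s0 : Set α}
    {σ : ℕ → TState α} (h : InducedSeq f P s0 σ) :
    ∀ i ≤ 2 * P.ncard, ∀ e ∈ (σ i).2.2, ∃ p ∈ P, e = schedOf p.1 (f p.2) := by
  intro i
  induction i with
  | zero =>
    intro _ e he
    simp [h.1] at he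
  | succ i ih =>
    intro hi e he
    have ih := ih (by omega)
    rcases (h.2 (i + 1) (by omega) hi).2 with ⟨b, hb, -, hE⟩ | ⟨d, -, -, -, hE⟩
    · rw [hE] at he
      rcases he with rfl | he
      · exact ⟨_, hb, rfl⟩
      · exact ih e he
    · rw [hE] at he
      exact ih e he.1

/-- Scheduled effects of an induced sequence are determined by their end times. -/
lemma InducedSeq.sched_injOn {f : β → DAction α} {P : Set (ℝ × β)} {s0 : Set α}
    {σ : ℕ → TState α} (h : InducedSeq f P s0 σ) (hP : IsPlan f P)
    {i : ℕ} (hi : i ≤ 2 * P.ncard) : InjOn Prod.fst (σ i).2.2 := by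
  intro d hd e he hde
  obtain ⟨p, hp, rfl⟩ := h.exists_schedOf i hi d hd
  obtain ⟨q, hq, rfl⟩ := h.exists_schedOf i hi e he
  by_cases hpq : p = q
  · rw [hpq]
  · exact absurd hde (hP.2.2 p hp q hq hpq).2.2

lemma InducedSeq.projState {X : Set (Mux α)} {P : Set (ℝ × ActTerm α)} {s0 : Set α}
    {σ : ℕ → TState (ExtAtom α)} (hP : IsPlan (safeA X) P)
    (h : InducedSeq (safeA X) P (Sum.inl '' s0 ∪ Sum.inr '' X) σ) :
    InducedSeq ActTerm.toA P s0 (fun i => _root_.projState (σ i)) := by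
  refine ⟨?_, fun i h1 hi => ?_⟩
  · simp only [h.1, _root_.projState, preimage_inl_image_union, image_empty]
  · obtain ⟨hc, hs⟩ := h.2 i h1 hi
    refine ⟨by rwa [candTimes_projState X], ?_⟩
    rcases hs with ⟨b, hb, hS, hE⟩ | ⟨e, he, ht, hS, hE⟩
    · refine Or.inl ⟨b, hb, ?_, ?_⟩
      · simp only [_root_.projState, hS, safeA, preimage_union (s := Sum.inl '' b.toA.effSp),
          preimage_sdiff, preimage_inl_image, preimage_inl_image_union]
      · simp only [_root_.projState, hE, image_insert_eq, projSched_schedOf]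
    · refine Or.inr ⟨projSched e, mem_image_of_mem _ he, ht, ?_, ?_⟩
      · simp only [_root_.projState, hS, projSched, preimage_union, preimage_sdiff]
      · have hinj : InjOn projSched (σ (i - 1)).2.2 := fun d hd e he hde =>
          h.sched_injOn hP (by omega) hd he (by simpa [projSched] using congrArg Prod.fst hde)
        simp only [_root_.projState, hE]
        rw [hinj.image_sdiff_subset (singleton_subset_iff.2 he), image_singleton]

lemma Consistent.projState {X : Set (Mux α)} {P : Set (ℝ × ActTerm α)}
    {σ : ℕ → TState (ExtAtom α)} (h : Consistent (safeA X) P σ) :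
    Consistent ActTerm.toA P (fun i => _root_.projState (σ i)) := by
  intro i h1 hi
  obtain ⟨hinv, hstart, hend⟩ := h i h1 hi
  refine ⟨?_, fun b hb v hv => ?_, ?_⟩
  · rintro _ ⟨e, he, rfl⟩
    exact preimage_mono (hinv e he)
  · exact hstart b hb (Or.inl (mem_image_of_mem _ hv))
  · rintro _ ⟨e, he, rfl⟩ ht
    exact preimage_mono (hend e he ht)

end Projection

/-- **Proposition 1.** If `P#` is a solution for the effect-safe task `T#` of a
temporal planning task `T = (V, A, s0, g)`, then the base plan
`P = {(t, a) | (t, a#) ∈ P#}` of `P#` is a solution for `T`. -/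
theorem base_plan_is_solution {α : Type*} (V : Set α) (A : Set (ActTerm α))
    (s0 g : Set α) (hT : TaskWF V A s0 g)
    (P : Set (ℝ × ActTerm α)) (hP : SafeSolution A s0 g P) :
    (∀ p ∈ P, p.2 ∈ A) ∧ OrigSolution s0 g P := by
  obtain ⟨hA, hplan, σ, hσ, hcons, hg⟩ := hP
  exact ⟨hA, (isPlan_toA_iff _ P).2 hplan, _, hσ.projState hplan, hcons.projState,
    image_subset_iff.1 hg⟩
end

section
/- Let P be the base plan of a solution P# for an effect-safe task T# = (V#, A#, s0#, s*). Then for every time-stamped action (t, a) ∈ P: (1) refine_P(v, (t, t)) < t for each v ∈ pre_s(a); (2) refine_P(v, (t_{ind(t)+1}, t + dur(a))) ≤ t for each v ∈ pre_inv(a); and (3) refine_P(v, (t + dur(a), t + dur(a))) < t + dur(a) for each v ∈ pre_e(a), where ind(t) denotes the sequence position of time stamp t in the event sequence induced by P. -/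
open Set

section InducedSequences

variable {α β : Type*} {f : β → DAction α} {P : Set (ℝ × β)} {s0 : Set α} {σ : ℕ → TState α}

/-- The scheduled effects of the actions of `P` that are in progress at time `τ`. -/
def activeScheds (f : β → DAction α) (P : Set (ℝ × β)) (τ : ℝ) : Set (Sched α) :=
  {e | ∃ p ∈ P, p.1 ≤ τ ∧ τ < p.1 + (f p.2).dur ∧ e = schedOf p.1 (f p.2)}

/-- The event times of `P` that can follow an event at time `τ`. -/
def nextTimes (f : β → DAction α) (P : Set (ℝ × β)) (τ : ℝ) : Set ℝ :=
  {t | (∃ p ∈ P, p.1 = t ∧ τ < p.1) ∨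
    ∃ p ∈ P, p.1 + (f p.2).dur = t ∧ p.1 ≤ τ ∧ τ < p.1 + (f p.2).dur}

lemma lt_of_mem_nextTimes {τ t : ℝ} (h : t ∈ nextTimes f P τ) : τ < t := by
  rcases h with ⟨p, _, rfl, h⟩ | ⟨p, _, rfl, _, h⟩ <;> exact h

lemma candTimes_eq_nextTimes {st : TState α} (h : st.2.2 = activeScheds f P st.1) :
    candTimes f P st = nextTimes f P st.1 := by
  ext t
  simp only [candTimes, nextTimes, h, activeScheds, mem_union, mem_ofPred_eq]
  constructor
  · rintro (⟨b, hb, hlt⟩ | ⟨e, ⟨p, hp, h1, h2, rfl⟩, rfl⟩)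
    · exact Or.inl ⟨_, hb, rfl, hlt⟩
    · exact Or.inr ⟨p, hp, rfl, h1, h2⟩
  · rintro (⟨p, hp, rfl, hlt⟩ | ⟨p, hp, rfl, h1, h2⟩)
    · exact Or.inl ⟨p.2, hp, hlt⟩
    · exact Or.inr ⟨_, ⟨p, hp, h1, h2, rfl⟩, rfl⟩

lemma IsPlan.eq_of_start_eq (hP : IsPlan f P) {p q : ℝ × β} (hp : p ∈ P) (hq : q ∈ P)
    (h : p.1 = q.1) : p = q := by
  by_contra hne
  exact (hP.2.2 p hp q hq hne).1 h

lemma IsPlan.eq_of_end_eq (hP : IsPlan f P) {p q : ℝ × β} (hp : p ∈ P) (hq : q ∈ P)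
    (h : p.1 + (f p.2).dur = q.1 + (f q.2).dur) : p = q := by
  by_contra hne
  exact (hP.2.2 p hp q hq hne).2.2 h

lemma IsPlan.end_ne_start (hP : IsPlan f P) (hd : ∀ p ∈ P, 0 < (f p.2).dur) {p q : ℝ × β}
    (hp : p ∈ P) (hq : q ∈ P) : p.1 + (f p.2).dur ≠ q.1 := by
  by_cases hne : p = q
  · subst hne
    have := hd p hp
    linarith
  · exact (hP.2.2 p hp q hq hne).2.1

lemma start_le_of_lt_next {τ t : ℝ} (h : IsLeast (nextTimes f P τ) t) {p : ℝ × β} (hp : p ∈ P)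
    (hlt : p.1 < t) : p.1 ≤ τ := by
  by_contra! hc
  exact absurd (h.2 (Or.inl ⟨p, hp, rfl, hc⟩)) (not_le.2 hlt)

lemma next_le_end {τ t : ℝ} (h : IsLeast (nextTimes f P τ) t) {p : ℝ × β} (hp : p ∈ P)
    (h1 : p.1 ≤ τ) (h2 : τ < p.1 + (f p.2).dur) : t ≤ p.1 + (f p.2).dur :=
  h.2 (Or.inr ⟨p, hp, rfl, h1, h2⟩)

lemma InducedSeq.scheds_eq (hP : IsPlan f P) (hd : ∀ p ∈ P, 0 < (f p.2).dur)
    (hσ : InducedSeq f P s0 σ) :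
    ∀ i ≤ 2 * P.ncard, (σ i).2.2 = activeScheds f P (σ i).1 := by
  intro i
  induction i with
  | zero =>
    intro _
    rw [hσ.1]
    symm
    refine eq_empty_of_forall_notMem ?_
    rintro e ⟨p, hp, h1, _⟩
    exact absurd h1 (not_le.2 (hP.2.1 p hp))
  | succ i ih =>
    intro hi
    have ihE := ih (by omega)
    obtain ⟨hc, hev⟩ := hσ.2 (i + 1) (by omega) hi
    rw [Nat.add_sub_cancel] at hc hev
    rw [candTimes_eq_nextTimes ihE] at hc
    have hl : IsLeast (nextTimes f P (σ i).1) (σ (i + 1)).1 := hc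
    have hlt := lt_of_mem_nextTimes hl.1
    rcases hev with ⟨b, hb, _, hE⟩ | ⟨e, he, het, _, hE⟩
    · rw [hE, ihE]
      ext e
      constructor
      · rintro (rfl | ⟨p, hp, h1, h2, rfl⟩)
        · exact ⟨_, hb, le_rfl, lt_add_of_pos_right _ (hd _ hb), rfl⟩
        · exact ⟨p, hp, h1.trans hlt.le, lt_of_le_of_ne (next_le_end hl hp h1 h2)
            (hP.end_ne_start hd hp hb).symm, rfl⟩
      · rintro ⟨p, hp, h1, h2, rfl⟩
        rcases h1.eq_or_lt with h1 | h1
        · obtain rfl := hP.eq_of_start_eq hp hb h1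
          exact Or.inl rfl
        · exact Or.inr ⟨p, hp, start_le_of_lt_next hl hp h1, hlt.trans h2, rfl⟩
    · rw [ihE] at he
      obtain ⟨q, hq, hq1, hq2, rfl⟩ := he
      have het' : q.1 + (f q.2).dur = (σ (i + 1)).1 := het
      rw [hE, ihE]
      ext e
      constructor
      · rintro ⟨⟨p, hp, h1, h2, rfl⟩, hne⟩
        refine ⟨p, hp, h1.trans hlt.le, lt_of_le_of_ne (next_le_end hl hp h1 h2) ?_, rfl⟩
        intro h
        obtain rfl := hP.eq_of_end_eq hq hp (het'.trans h)
        exact hne rfl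
      · rintro ⟨p, hp, h1, h2, rfl⟩
        have h1' : p.1 < (σ (i + 1)).1 :=
          lt_of_le_of_ne h1 fun h => hP.end_ne_start hd hq hp (het'.trans h.symm)
        refine ⟨⟨p, hp, start_le_of_lt_next hl hp h1', hlt.trans h2, rfl⟩, ?_⟩
        intro h
        have : p.1 + (f p.2).dur = q.1 + (f q.2).dur := congrArg Prod.fst h
        linarith

lemma InducedSeq.isLeast_nextTimes (hP : IsPlan f P) (hd : ∀ p ∈ P, 0 < (f p.2).dur)
    (hσ : InducedSeq f P s0 σ) {i : ℕ} (hi : i < 2 * P.ncard) :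
    IsLeast (nextTimes f P (σ i).1) (σ (i + 1)).1 := by
  have h := (hσ.2 (i + 1) (by omega) hi).1
  rwa [Nat.add_sub_cancel, candTimes_eq_nextTimes (hσ.scheds_eq hP hd i hi.le)] at h

lemma InducedSeq.strictMonoOn (hP : IsPlan f P) (hd : ∀ p ∈ P, 0 < (f p.2).dur)
    (hσ : InducedSeq f P s0 σ) :
    StrictMonoOn (fun i => (σ i).1) (Iic (2 * P.ncard)) :=
  strictMonoOn_Iic_of_lt_succ fun i hi =>
    lt_of_mem_nextTimes (hσ.isLeast_nextTimes hP hd (by simpa using hi)).1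

lemma InducedSeq.time_nonneg (hP : IsPlan f P) (hd : ∀ p ∈ P, 0 < (f p.2).dur)
    (hσ : InducedSeq f P s0 σ) {i : ℕ} (hi : i ≤ 2 * P.ncard) : 0 ≤ (σ i).1 := by
  have h := (hσ.strictMonoOn hP hd).monotoneOn (mem_Iic.2 (Nat.zero_le _)) (mem_Iic.2 hi)
    (Nat.zero_le i)
  simpa [hσ.1] using h

/-- Every starting or ending time occurs in the induced sequence. -/
lemma InducedSeq.exists_index (hP : IsPlan f P) (hd : ∀ p ∈ P, 0 < (f p.2).dur)
    (hσ : InducedSeq f P s0 σ) {t : ℝ}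
    (ht : ∃ p ∈ P, p.1 = t ∨ p.1 + (f p.2).dur = t) :
    ∃ i < 2 * P.ncard, (σ (i + 1)).1 = t := by
  set S : Set ℝ := (fun p : ℝ × β => p.1) '' P ∪ (fun p : ℝ × β => p.1 + (f p.2).dur) '' P
    with hS
  have hSfin : S.Finite := (hP.1.image _).union (hP.1.image _)
  set I : Set ℝ := (fun i => (σ i).1) '' Icc 1 (2 * P.ncard)
  have hsub : I ⊆ S := by
    rintro _ ⟨i, ⟨hi1, hi2⟩, rfl⟩
    obtain ⟨i, rfl⟩ : ∃ k, i = k + 1 := ⟨i - 1, by omega⟩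
    rcases (hσ.isLeast_nextTimes hP hd (i := i) (by omega)).1 with ⟨p, hp, h, _⟩ | ⟨p, hp, h, _⟩
    · exact Or.inl ⟨p, hp, h⟩
    · exact Or.inr ⟨p, hp, h⟩
  have hcard : S.ncard ≤ I.ncard := by
    have h1 : I.ncard = 2 * P.ncard := by
      rw [InjOn.ncard_image ((hσ.strictMonoOn hP hd).injOn.mono fun i hi => hi.2)]
      simp [← Finset.coe_Icc]
    have h2 := ncard_union_le ((fun p : ℝ × β => p.1) '' P)
      ((fun p : ℝ × β => p.1 + (f p.2).dur) '' P)
    have h3 := ncard_image_le (f := fun p : ℝ × β => p.1) hP.1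
    have h4 := ncard_image_le (f := fun p : ℝ × β => p.1 + (f p.2).dur) hP.1
    rw [← hS] at h2
    omega
  have heq := eq_of_subset_of_ncard_le hsub hcard hSfin
  have htS : t ∈ S := by
    obtain ⟨p, hp, h | h⟩ := ht
    · exact Or.inl ⟨p, hp, h⟩
    · exact Or.inr ⟨p, hp, h⟩
  rw [← heq] at htS
  obtain ⟨i, ⟨hi1, hi2⟩, rfl⟩ := htS
  exact ⟨i - 1, by omega, by simp [Nat.sub_add_cancel hi1]⟩

/-- Every position is a starting or an ending event, with the corresponding state update. -/
lemma InducedSeq.event (hP : IsPlan f P) (hd : ∀ p ∈ P, 0 < (f p.2).dur)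
    (hσ : InducedSeq f P s0 σ) {i : ℕ} (hi : i < 2 * P.ncard) :
    (∃ p ∈ P, p.1 = (σ (i + 1)).1 ∧
      (σ (i + 1)).2.1 = (f p.2).effSp ∪ ((σ i).2.1 \ (f p.2).effSm)) ∨
    (∃ p ∈ P, p.1 ≤ (σ i).1 ∧ p.1 + (f p.2).dur = (σ (i + 1)).1 ∧
      (σ (i + 1)).2.1 = (f p.2).effEp ∪ ((σ i).2.1 \ (f p.2).effEm)) := by
  have h := (hσ.2 (i + 1) (by omega) hi).2
  rw [Nat.add_sub_cancel, hσ.scheds_eq hP hd i hi.le] at h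
  rcases h with ⟨b, hb, hs, _⟩ | ⟨_, ⟨p, hp, h1, _, rfl⟩, ht, hs, _⟩
  · exact Or.inl ⟨_, hb, rfl, hs⟩
  · exact Or.inr ⟨p, hp, h1, ht, hs⟩

lemma InducedSeq.state_of_start (hP : IsPlan f P) (hd : ∀ p ∈ P, 0 < (f p.2).dur)
    (hσ : InducedSeq f P s0 σ) {i : ℕ} (hi : i < 2 * P.ncard) {p : ℝ × β} (hp : p ∈ P)
    (ht : p.1 = (σ (i + 1)).1) :
    (σ (i + 1)).2.1 = (f p.2).effSp ∪ ((σ i).2.1 \ (f p.2).effSm) := by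
  rcases hσ.event hP hd hi with ⟨q, hq, h, hs⟩ | ⟨q, hq, _, h, _⟩
  · obtain rfl := hP.eq_of_start_eq hp hq (ht.trans h.symm)
    exact hs
  · exact absurd (h.trans ht.symm) (hP.end_ne_start hd hq hp)

lemma InducedSeq.state_of_end (hP : IsPlan f P) (hd : ∀ p ∈ P, 0 < (f p.2).dur)
    (hσ : InducedSeq f P s0 σ) {i : ℕ} (hi : i < 2 * P.ncard) {p : ℝ × β} (hp : p ∈ P)
    (ht : p.1 + (f p.2).dur = (σ (i + 1)).1) :
    (σ (i + 1)).2.1 = (f p.2).effEp ∪ ((σ i).2.1 \ (f p.2).effEm) := by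
  rcases hσ.event hP hd hi with ⟨q, hq, h, _⟩ | ⟨q, hq, _, h, hs⟩
  · exact absurd (ht.trans h.symm) (hP.end_ne_start hd hp hq)
  · obtain rfl := hP.eq_of_end_eq hp hq (ht.trans h.symm)
    exact hs

lemma Consistent.preS_subset (hc : Consistent f P σ) {i : ℕ} (hi : i < 2 * P.ncard)
    {p : ℝ × β} (hp : p ∈ P) (ht : p.1 = (σ (i + 1)).1) : (f p.2).preS ⊆ (σ i).2.1 :=
  (hc (i + 1) (by omega) hi).2.1 p.2 (ht ▸ hp)

lemma Consistent.preE_subset (hc : Consistent f P σ) (hP : IsPlan f P)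
    (hd : ∀ p ∈ P, 0 < (f p.2).dur) (hσ : InducedSeq f P s0 σ) {i : ℕ} (hi : i < 2 * P.ncard)
    {p : ℝ × β} (hp : p ∈ P) (ht : p.1 + (f p.2).dur = (σ (i + 1)).1) :
    (f p.2).preE ⊆ (σ i).2.1 := by
  have hl := hσ.isLeast_nextTimes hP hd hi
  have h := (hc (i + 1) (by omega) hi).2.2
  rw [Nat.add_sub_cancel, hσ.scheds_eq hP hd i hi.le] at h
  refine h (schedOf p.1 (f p.2)) ⟨p, hp, start_le_of_lt_next hl hp ?_, ?_, rfl⟩ ht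
  · linarith [hd p hp]
  · exact (lt_of_mem_nextTimes hl.1).trans_eq ht.symm

lemma Consistent.preInv_subset (hc : Consistent f P σ) (hP : IsPlan f P)
    (hd : ∀ p ∈ P, 0 < (f p.2).dur) (hσ : InducedSeq f P s0 σ) {i : ℕ} (hi : i ≤ 2 * P.ncard)
    {p : ℝ × β} (hp : p ∈ P) (h1 : p.1 ≤ (σ i).1) (h2 : (σ i).1 < p.1 + (f p.2).dur) :
    (f p.2).preInv ⊆ (σ i).2.1 := by
  have hi0 : i ≠ 0 := by
    rintro rfl
    rw [hσ.1] at h1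
    exact absurd h1 (not_le.2 (hP.2.1 p hp))
  have h := (hc i (by omega) hi).1
  rw [hσ.scheds_eq hP hd i hi] at h
  exact h _ ⟨p, hp, h1, h2, rfl⟩

end InducedSequences

section EffectSafePlans

variable {α : Type*} {X : Set (Mux α)} {P : Set (ℝ × ActTerm α)} {s0 : Set α}
  {σ : ℕ → TState α} {ρ : ℕ → TState (ExtAtom α)}

lemma ActTerm.Good.dur_pos : ∀ {b : ActTerm α}, b.Good → 0 < b.toA.dur
  | .prim _, h => h.1
  | .comp _ _, h => add_pos h.1.dur_pos h.2.1.dur_pos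

/-- A macro-action with mutex atom `x(v)` deletes `v` at its start. -/
lemma ActTerm.mem_effSm_of_mem_aux {v : α} :
    ∀ {b : ActTerm α}, (true, v) ∈ b.aux → v ∈ b.toA.effSm ∧ v ∉ b.toA.effSp
  | .prim _, h => absurd h (notMem_empty _)
  | .comp b1 b2, h => by
    have hv : v ∈ b1.toA.effEm ∪ b2.toA.effSm := by
      rcases h with (⟨h, _⟩ | ⟨_, h⟩) | h
      · exact absurd h Bool.noConfusion
      · exact h
      · exact Or.inr (ActTerm.mem_effSm_of_mem_aux h).1
    exact ⟨Or.inr hv, fun h => h.2 hv⟩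

/-- The sequence induced by a base plan is the projection of the sequence induced by the plan of
effect-safe actions. -/
lemma InducedSeq.base_eq (hP : IsPlan ActTerm.toA P) (hd : ∀ p ∈ P, 0 < p.2.toA.dur)
    (hσ : InducedSeq ActTerm.toA P s0 σ)
    (hρ : InducedSeq (safeA X) P (Sum.inl '' s0 ∪ Sum.inr '' X) ρ) :
    ∀ i ≤ 2 * P.ncard, (ρ i).1 = (σ i).1 ∧ ∀ v, Sum.inl v ∈ (ρ i).2.1 ↔ v ∈ (σ i).2.1 := by
  have hP' : IsPlan (safeA X) P := hP
  have hd' : ∀ p ∈ P, 0 < (safeA X p.2).dur := hd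
  intro i
  induction i with
  | zero =>
    intro _
    rw [hσ.1, hρ.1]
    simp
  | succ i ih =>
    intro hi
    obtain ⟨iht, ihs⟩ := ih (by omega)
    have ht : (ρ (i + 1)).1 = (σ (i + 1)).1 := by
      have h := hρ.isLeast_nextTimes hP' hd' hi
      rw [iht] at h
      exact h.unique (hσ.isLeast_nextTimes hP hd hi)
    refine ⟨ht, fun v => ?_⟩
    rcases hσ.event hP hd hi with ⟨p, hp, h, hs⟩ | ⟨p, hp, _, h, hs⟩
    · rw [hs, hρ.state_of_start hP' hd' hi hp (h.trans ht.symm)]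
      simp [safeA, ihs]
    · rw [hs, hρ.state_of_end hP' hd' hi hp (h.trans ht.symm)]
      simp [safeA, ihs]

/-- While a macro-action is in progress its mutex atoms are false, and no other macro-action
sharing a mutex atom with it is in progress. -/
lemma Consistent.mutex (hP : IsPlan (safeA X) P) (hd : ∀ p ∈ P, 0 < p.2.toA.dur)
    {r0 : Set (ExtAtom α)} (hρ : InducedSeq (safeA X) P r0 ρ) (hc : Consistent (safeA X) P ρ) (m : Mux α) :
    ∀ i ≤ 2 * P.ncard, ∀ q ∈ P, m ∈ q.2.aux → q.1 ≤ (ρ i).1 → (ρ i).1 < q.1 + q.2.toA.dur →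
      Sum.inr m ∉ (ρ i).2.1 ∧ ∀ q' ∈ P, m ∈ q'.2.aux → q'.1 ≤ (ρ i).1 →
        (ρ i).1 < q'.1 + q'.2.toA.dur → q' = q := by
  have hd' : ∀ p ∈ P, 0 < (safeA X p.2).dur := hd
  intro i
  induction i with
  | zero =>
    intro _ q hq _ h1
    rw [hρ.1] at h1
    exact absurd h1 (not_le.2 (hP.2.1 q hq))
  | succ i ih =>
    intro hi
    have ih := ih (by omega)
    have hl := hρ.isLeast_nextTimes hP hd' hi
    have hlt := lt_of_mem_nextTimes hl.1
    rcases hρ.event hP hd' hi with ⟨p, hp, hpt, hs⟩ | ⟨p, hp, hp1, hpt, hs⟩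
    · have back : ∀ q ∈ P, q.1 ≤ (ρ (i + 1)).1 → q ≠ p → q.1 ≤ (ρ i).1 := fun q hq h1 hne =>
        start_le_of_lt_next hl hq <| lt_of_le_of_ne h1 fun h =>
          hne (hP.eq_of_start_eq hq hp (h.trans hpt.symm))
      have excl : m ∈ p.2.aux → ∀ q ∈ P, m ∈ q.2.aux → q.1 ≤ (ρ (i + 1)).1 →
          (ρ (i + 1)).1 < q.1 + q.2.toA.dur → q = p := by
        intro hmp q hq hm h1 h2
        by_contra hne
        refine (ih q hq hm (back q hq h1 hne) (hlt.trans h2)).1 (hc.preS_subset hi hp hpt ?_)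
        exact Or.inr ⟨m, Or.inl (Or.inl hmp), rfl⟩
      intro q hq hm h1 h2
      by_cases hmp : m ∈ p.2.aux
      · obtain rfl := excl hmp q hq hm h1 h2
        refine ⟨?_, fun q' hq' hm' h1' h2' => excl hmp q' hq' hm' h1' h2'⟩
        rw [hs]
        simp [safeA, hmp]
      · have hne : ∀ q : ℝ × ActTerm α, m ∈ q.2.aux → q ≠ p := by
          rintro q hm rfl
          exact hmp hm
        obtain ⟨h3, h4⟩ := ih q hq hm (back q hq h1 (hne q hm)) (hlt.trans h2)
        refine ⟨?_, fun q' hq' hm' h1' h2' =>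
          h4 q' hq' hm' (back q' hq' h1' (hne q' hm')) (hlt.trans h2')⟩
        rw [hs]
        simp [safeA, h3]
    · have back : ∀ q ∈ P, q.1 ≤ (ρ (i + 1)).1 → q.1 ≤ (ρ i).1 := fun q hq h1 =>
        start_le_of_lt_next hl hq <| lt_of_le_of_ne h1 fun h =>
          hP.end_ne_start hd' hp hq (hpt.trans h.symm)
      have hpe : p.1 + p.2.toA.dur = (ρ (i + 1)).1 := hpt
      intro q hq hm h1 h2
      obtain ⟨h3, h4⟩ := ih q hq hm (back q hq h1) (hlt.trans h2)
      have hmp : m ∉ p.2.aux := by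
        intro hmp
        obtain rfl := h4 p hp hmp hp1 (hlt.trans_eq hpe.symm)
        exact absurd h2 (not_lt.2 hpe.le)
      refine ⟨?_, fun q' hq' hm' h1' h2' => h4 q' hq' hm' (back q' hq' h1') (hlt.trans h2')⟩
      rw [hs]
      simp [safeA, h3, hmp]

/-- If an atom holds throughout the positions `j, …, k - 1`, then it can be traced back to an
establishing time stamp at or before position `j`. -/
lemma refineT_le_of_forall_mem (hP : IsPlan ActTerm.toA P) (hd : ∀ p ∈ P, 0 < p.2.toA.dur)
    (hX : ∀ p ∈ P, p.2.aux ⊆ X) (hσ : InducedSeq ActTerm.toA P s0 σ)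
    (hρ : InducedSeq (safeA X) P (Sum.inl '' s0 ∪ Sum.inr '' X) ρ)
    (hc : Consistent (safeA X) P ρ) {v : α} {j k : ℕ} (hjk : j < k) (hk : k ≤ 2 * P.ncard)
    (hv : ∀ i, j ≤ i → i < k → v ∈ (σ i).2.1) :
    refineT P σ v (σ (j + 1)).1 (σ k).1 ≤ (σ j).1 := by
  have hP' : IsPlan (safeA X) P := hP
  have hd' : ∀ p ∈ P, 0 < (safeA X p.2).dur := hd
  have hmono := hσ.strictMonoOn hP hd
  have lt_iff : ∀ {a b : ℕ}, a ≤ 2 * P.ncard → b ≤ 2 * P.ncard → ((σ a).1 < (σ b).1 ↔ a < b) :=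
    fun ha hb => hmono.lt_iff_lt (mem_Iic.2 ha) (mem_Iic.2 hb)
  have le_iff : ∀ {a b : ℕ}, a ≤ 2 * P.ncard → b ≤ 2 * P.ncard → ((σ a).1 ≤ (σ b).1 ↔ a ≤ b) :=
    fun ha hb => hmono.le_iff_le (mem_Iic.2 ha) (mem_Iic.2 hb)
  have hbdd : ∀ {S T U : Set ℝ}, (∀ x ∈ S, 0 ≤ x) → (∀ x ∈ T, 0 ≤ x) → (∀ x ∈ U, 0 ≤ x) →
      BddBelow ({sSup (evTimes ActTerm.toA P)} ∪ S ∪ T ∪ U) := by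
    intro S T U hS hT hU
    refine ⟨0, ?_⟩
    rintro x (((rfl | hx) | hx) | hx)
    · refine le_csSup (Set.Finite.bddAbove ?_) (mem_insert _ _)
      have h : evTimes ActTerm.toA P = insert 0 ((fun p : ℝ × ActTerm α => p.1) '' P ∪
          (fun p : ℝ × ActTerm α => p.1 + p.2.toA.dur) '' P) := by
        ext t
        simp [evTimes]
      rw [h]
      exact ((hP.1.image _).union (hP.1.image _)).insert 0
    · exact hS x hx
    · exact hT x hx
    · exact hU x hx
  have hle : ∀ τ, τ ≤ (σ j).1 → _ → refineT P σ v (σ (j + 1)).1 (σ k).1 ≤ (σ j).1 :=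
    fun τ h1 h2 => (csInf_le (a := τ) (hbdd
      (by rintro x ⟨p, hp, rfl, _⟩; exact (add_pos (hP.2.1 p hp) (hd p hp)).le)
      (by rintro x ⟨p, hp, rfl, _⟩; exact (hP.2.1 p hp).le)
      (by rintro x ⟨rfl, _⟩; exact le_rfl)) h2).trans h1
  -- a macro-action with mutex atom `x(v)` cannot start while `v` stays true
  have hdel : ∀ q ∈ P, (true, v) ∈ q.2.aux → ∀ i, (∀ n, i ≤ n → n < k → v ∈ (σ n).2.1) →
      i ≤ 2 * P.ncard → (σ i).1 ≤ q.1 → ¬ q.1 < (σ k).1 := by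
    intro q hq hm i hin hi h1 h2
    obtain ⟨n, hn, hnq⟩ := hσ.exists_index hP hd ⟨q, hq, Or.inl rfl⟩
    rw [← hnq] at h1 h2
    have hmem := hin _ ((le_iff hi hn).1 h1) ((lt_iff hn hk).1 h2)
    rw [hσ.state_of_start hP hd hn hq hnq.symm] at hmem
    have haux := ActTerm.mem_effSm_of_mem_aux hm
    rcases hmem with h | h
    · exact haux.2 h
    · exact h.2 haux.1
  classical
  have hex : ∃ i, ∀ n, i ≤ n → n < k → v ∈ (σ n).2.1 := ⟨j, hv⟩
  obtain ⟨i, hi, hmin⟩ : ∃ i, (∀ n, i ≤ n → n < k → v ∈ (σ n).2.1) ∧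
      ∀ i' < i, ¬ ∀ n, i' ≤ n → n < k → v ∈ (σ n).2.1 :=
    ⟨Nat.find hex, Nat.find_spec hex, fun _ h => Nat.find_min hex h⟩
  have hij : i ≤ j := not_lt.1 fun h => hmin j h hv
  have htij : (σ i).1 ≤ (σ j).1 := (le_iff (by omega) (by omega)).2 hij
  have htj : (σ i).1 < (σ (j + 1)).1 := (lt_iff (by omega) (by omega)).2 (by omega)
  have hstay : ∀ n ≤ 2 * P.ncard, (σ i).1 ≤ (σ n).1 → (σ n).1 < (σ k).1 → v ∈ (σ n).2.1 :=
    fun n hn h1 h2 => hi n ((le_iff (by omega) hn).1 h1) ((lt_iff hn hk).1 h2)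
  rcases Nat.eq_zero_or_pos i with rfl | hpos
  · refine hle 0 (hσ.time_nonneg hP hd (by omega)) (Or.inr ⟨rfl, fun n hn h => ?_, ?_⟩)
    · exact hi n (Nat.zero_le _) ((lt_iff hn hk).1 h)
    · rintro ⟨q, hq, hm, hlt⟩
      refine hdel q hq hm 0 hi (Nat.zero_le _) ?_ hlt
      rw [hσ.1]
      exact (hP.2.1 q hq).le
  · obtain ⟨i, rfl⟩ : ∃ l, i = l + 1 := ⟨i - 1, by omega⟩
    have hi2 : i < 2 * P.ncard := by omega
    have hvi1 : v ∈ (σ (i + 1)).2.1 := hi _ le_rfl (by omega)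
    have hvi : v ∉ (σ i).2.1 := by
      intro h
      refine hmin i (Nat.lt_succ_self _) fun n h1 h2 => ?_
      rcases h1.eq_or_lt with rfl | h1
      · exact h
      · exact hi n h1 h2
    obtain ⟨ht, -⟩ := hσ.base_eq hP hd hρ i hi2.le
    obtain ⟨ht1, -⟩ := hσ.base_eq hP hd hρ (i + 1) hi2
    have hl := hσ.isLeast_nextTimes hP hd hi2
    have hlt := lt_of_mem_nextTimes hl.1
    have hmut := hc.mutex hP' hd hρ (true, v) i hi2.le
    rw [ht] at hmut
    rcases hσ.event hP hd hi2 with ⟨p, hp, hpt, hs⟩ | ⟨p, hp, hp1, hpt, hs⟩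
    · have hve : v ∈ p.2.toA.effSp := by
        rw [hs] at hvi1
        exact hvi1.resolve_right fun h => hvi h.1
      refine hle _ htij (Or.inl (Or.inr ⟨p, hp, hpt.symm, htj, hve, hstay, ?_⟩))
      rintro ⟨q, hq, hm, hqk, hqe⟩
      rcases lt_or_ge q.1 (σ (i + 1)).1 with hq1 | hq1
      · refine (hmut q hq hm (start_le_of_lt_next hl hq hq1) (hlt.trans hqe)).1 ?_
        refine hc.preS_subset hi2 hp (hpt.trans ht1.symm) (Or.inr ⟨_, Or.inr ⟨?_, ?_⟩, rfl⟩)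
        · exact hX q hq hm
        · exact Or.inl ⟨rfl, hve⟩
      · exact hdel q hq hm _ hi hi2 hq1 hqk
    · have hve : v ∈ p.2.toA.effEp := by
        rw [hs] at hvi1
        exact hvi1.resolve_right fun h => hvi h.1
      refine hle _ htij (Or.inl (Or.inl (Or.inr ⟨p, hp, hpt.symm, htj, hve, hstay, ?_⟩)))
      rintro ⟨q, hq, hm, hqk, hqe⟩
      rcases lt_or_ge q.1 (σ (i + 1)).1 with hq1 | hq1
      · obtain ⟨h3, h4⟩ := hmut q hq hm (start_le_of_lt_next hl hq hq1) (hlt.trans hqe)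
        by_cases hmp : (true, v) ∈ p.2.aux
        · obtain rfl := h4 p hp hmp hp1 (hlt.trans_eq hpt.symm)
          exact absurd hqe (not_lt.2 hpt.le)
        · refine h3 (hc.preE_subset hP' hd' hρ hi2 hp (hpt.trans ht1.symm)
            (Or.inr ⟨_, ⟨⟨?_, hmp⟩, ?_⟩, rfl⟩))
          · exact hX q hq hm
          · exact Or.inl ⟨rfl, hve⟩
      · exact hdel q hq hm _ hi hi2 hq1 hqk

end EffectSafePlans

/-- The base plan `P` of a solution `P#` for an effect-safe task satisfies the
three `refine` bounds: for each `(t, a) ∈ P`,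
`refine_P(v, (t, t)) < t` for `v ∈ pre_s(a)`,
`refine_P(v, (t_{ind(t)+1}, t + dur(a))) ≤ t` for `v ∈ pre_inv(a)`, and
`refine_P(v, (t + dur(a), t + dur(a))) < t + dur(a)` for `v ∈ pre_e(a)`. -/
theorem base_plan_refine_bounds {α : Type*} (V : Set α) (A : Set (ActTerm α))
    (s0 g : Set α) (hT : TaskWF V A s0 g)
    (Ps : Set (ℝ × ActTerm α)) (hPs : SafeSolution A s0 g Ps)
    (σ : ℕ → TState α) (hσ : InducedSeq ActTerm.toA Ps s0 σ) :
    RefineBounds Ps σ := by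
  obtain ⟨hA, hP, ρ, hρ, hc, -⟩ := hPs
  have hPb : IsPlan ActTerm.toA Ps := hP
  have hd : ∀ p ∈ Ps, 0 < p.2.toA.dur := fun p hp => (hT.2.2.2 p.2 (hA p hp)).1.dur_pos
  have hd' : ∀ p ∈ Ps, 0 < (safeA (auxOf A) p.2).dur := hd
  have hX : ∀ p ∈ Ps, p.2.aux ⊆ auxOf A := fun p hp => subset_biUnion_of_mem (hA p hp)
  have base := hσ.base_eq hPb hd hρ
  have single : ∀ {v : α} {i : ℕ}, i < 2 * Ps.ncard → v ∈ (σ i).2.1 →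
      refineT Ps σ v (σ (i + 1)).1 (σ (i + 1)).1 < (σ (i + 1)).1 := by
    intro v i hi hv
    refine (refineT_le_of_forall_mem hPb hd hX hσ hρ hc (Nat.lt_succ_self i) hi ?_).trans_lt
      (lt_of_mem_nextTimes (hσ.isLeast_nextTimes hPb hd hi).1)
    intro n h1 h2
    obtain rfl : n = i := by omega
    exact hv
  intro p hp
  refine ⟨fun v hv => ?_, fun v hv j hj hjt => ?_, fun v hv => ?_⟩
  · obtain ⟨i, hi, ht⟩ := hσ.exists_index hPb hd ⟨p, hp, Or.inl rfl⟩
    rw [← ht]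
    refine single hi (((base i hi.le).2 v).1 (hc.preS_subset hi hp ?_ (Or.inl ⟨v, hv, rfl⟩)))
    exact ht.symm.trans (base (i + 1) hi).1.symm
  · obtain ⟨k, hk, ht⟩ := hσ.exists_index hPb hd ⟨p, hp, Or.inr rfl⟩
    have hmono := hσ.strictMonoOn hPb hd
    rw [← ht, ← hjt]
    refine refineT_le_of_forall_mem hPb hd hX hσ hρ hc ?_ hk ?_
    · refine (hmono.lt_iff_lt (mem_Iic.2 hj.le) (mem_Iic.2 hk)).1 ?_
      change (σ j).1 < (σ (k + 1)).1
      rw [ht, hjt]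
      exact lt_add_of_pos_right _ (hd p hp)
    · intro n h1 h2
      have hn : n ≤ 2 * Ps.ncard := by omega
      have h1' : (σ j).1 ≤ (σ n).1 := hmono.monotoneOn (mem_Iic.2 hj.le) (mem_Iic.2 hn) h1
      have h2' : (σ n).1 < (σ (k + 1)).1 := hmono (mem_Iic.2 hn) (mem_Iic.2 hk) h2
      obtain ⟨hnt, hns⟩ := base n hn
      rw [hjt, ← hnt] at h1'
      rw [ht, ← hnt] at h2'
      exact (hns v).1 (hc.preInv_subset hP hd' hρ hn hp h1' h2' ⟨v, hv, rfl⟩)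
  · obtain ⟨i, hi, ht⟩ := hσ.exists_index hPb hd ⟨p, hp, Or.inr rfl⟩
    rw [← ht]
    refine single hi (((base i hi.le).2 v).1
      (hc.preE_subset hP hd' hρ hi hp ?_ (Or.inl ⟨v, hv, rfl⟩)))
    exact ht.symm.trans (base (i + 1) hi).1.symm
end

section
/- Let a1 and a2 be durative actions such that the macro-action a0 = a1 ⊕ a2 is defined. Then (pre_inv(a1) ∪ pre_e(a1) ∪ (pre_s(a2) ∖ eff_e+(a1))) ∖ pre_inv(a0) ⊆ (pre_s(a0) ∪ eff_s+(a1)) ∩ {v | x(¬v) ∈ aux(a0)}. -/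
open Set

/-- Preconditions of `a1` (and start preconditions of `a2` not enabled by the
end effects of `a1`) that are not invariants of the macro-action `a0 = a1 ⊕ a2`
are contained in its start preconditions or start add effects, and are
protected by mutex atoms `x(¬v) ∈ aux(a0)`. -/
theorem macro_pre_first_covered {α : Type*} (b1 b2 : ActTerm α)
    (h1 : b1.Good) (h2 : b2.Good) (hdef : MacroDefined b1.toA b2.toA) :
    (b1.toA.preInv ∪ b1.toA.preE ∪ (b2.toA.preS \ b1.toA.effEp)) \
        (macroComp b1.toA b2.toA).preInv ⊆
      ((macroComp b1.toA b2.toA).preS ∪ b1.toA.effSp) ∩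
        {v | (false, v) ∈ (ActTerm.comp b1 b2).aux} := by
  rintro v ⟨hv, hinv⟩
  have hcases : v ∈ (b1.toA.preInv ∪ b1.toA.preE) ∩ (b1.toA.effEm ∪ b2.toA.effSm) ∨
      v ∈ (b2.toA.preS ∩ b2.toA.effSm) \ b1.toA.effEp := by
    simp only [macroComp, mem_union, mem_sdiff, mem_inter_iff] at hv hinv ⊢
    tauto
  refine ⟨?_, Or.inl (Or.inl ⟨rfl, ?_, hinv⟩)⟩
  · simp only [macroComp, mem_union, mem_sdiff, mem_inter_iff] at hcases ⊢
    tauto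
  · rcases hcases with h | h
    · exact Or.inl (Or.inl (Or.inr h))
    · exact Or.inl (Or.inr h)
end

section
/- Let a1 and a2 be durative actions such that the macro-action a0 = a1 ⊕ a2 is defined. Then (pre_inv(a2) ∪ (pre_e(a2) ∖ pre_e(a0))) ∖ pre_inv(a0) ⊆ ((eff_s+(a2) ∪ eff_e+(a1)) ∖ eff_s−(a2)) ∩ {v | x(¬v) ∈ aux(a0)}. -/
open Set

namespace ActTerm

variable {α : Type*}

theorem Good.disjoint_effSm_effSp {b : ActTerm α} (h : b.Good) :
    Disjoint b.toA.effSm b.toA.effSp := by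
  induction b with
  | prim a => exact (disjoint_union_right.mp (disjoint_iff_inter_eq_empty.mpr h.2.1)).1
  | comp b1 b2 ih1 _ =>
    exact disjoint_union_left.mpr
      ⟨(ih1 h.1).mono_right sdiff_subset, disjoint_sdiff_right⟩

theorem Good.disjoint_effSm_preInv {b : ActTerm α} (h : b.Good) :
    Disjoint b.toA.effSm b.toA.preInv := by
  cases b with
  | prim a => exact (disjoint_union_right.mp (disjoint_iff_inter_eq_empty.mpr h.2.1)).2
  | comp b1 b2 => exact disjoint_iff_inter_eq_empty.mpr h.2.2.1

end ActTerm

/-- Invariants and end preconditions of `a2` (beyond those of the macro-action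
`a0 = a1 ⊕ a2`) that are not invariants of `a0` are enabled during `a0` by
`eff_s+(a2) ∪ eff_e+(a1)` without being deleted by `eff_s−(a2)`, and are
protected by mutex atoms `x(¬v) ∈ aux(a0)`. -/
theorem macro_pre_second_covered {α : Type*} (b1 b2 : ActTerm α)
    (h1 : b1.Good) (h2 : b2.Good) (hdef : MacroDefined b1.toA b2.toA) :
    (b2.toA.preInv ∪ (b2.toA.preE \ (macroComp b1.toA b2.toA).preE)) \
        (macroComp b1.toA b2.toA).preInv ⊆
      ((b2.toA.effSp ∪ b1.toA.effEp) \ b2.toA.effSm) ∩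
        {v | (false, v) ∈ (ActTerm.comp b1 b2).aux} := by
  rintro v ⟨hv, hnot⟩
  have hadd : v ∈ b1.toA.effEp ∪ b2.toA.effSp := by
    by_contra hn
    rcases hv with hv | hv
    · exact hnot (Or.inr ⟨hv, hn⟩)
    · exact hv.2 ⟨hv.1, hn⟩
  have hpre : v ∈ b2.toA.preInv ∪ b2.toA.preE := hv.imp id And.left
  refine ⟨⟨hadd.symm, fun hdel => ?_⟩, Or.inl (Or.inl ⟨rfl, Or.inr ⟨hpre, hadd⟩, hnot⟩)⟩
  rcases hpre with hv | hv
  · exact disjoint_left.mp h2.disjoint_effSm_preInv hdel hv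
  · exact disjoint_left.mp h2.disjoint_effSm_effSp hdel
      (sdiff_eq_empty.mp hdef.2 ⟨hv, Or.inr hdel⟩)
end

section
/- For any plan P, the inductive construction of the induced sequence of time-stamped states is well defined: for each 1 ≤ i ≤ 2|P|, the set {t | (t, a) ∈ P, t_{i−1} < t} ∪ {t | (t, pre_inv(a), pre_e(a), eff_e(a)) ∈ E_{i−1}} is nonempty so that its minimum t_i exists; exactly one of the two update cases applies at position i (σ_i is either a starting event for a unique (t_i, a) ∈ P or an ending event for a unique scheduled effect in E_{i−1}, but not both); each (t, a) ∈ P gives rise to exactly one starting event and exactly one ending event in the sequence; and E_{2|P|} = ∅. -/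
open Set

section InducedSequence

variable {α β : Type*}

/-- The starting and ending times of the time-stamped actions of `P`. -/
def eventTimes (f : β → DAction α) (P : Set (ℝ × β)) : Set ℝ :=
  (fun p => p.1) '' P ∪ (fun p => p.1 + (f p.2).dur) '' P

/-- The construction step of the induced sequence, as a relation on states. -/
def Step (f : β → DAction α) (P : Set (ℝ × β)) (st st' : TState α) : Prop :=
  (st'.1 ∈ candTimes f P st ∧ ∀ t ∈ candTimes f P st, st'.1 ≤ t) ∧
  ((∃ b, (st'.1, b) ∈ P ∧
      st'.2.1 = (f b).effSp ∪ (st.2.1 \ (f b).effSm) ∧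
      st'.2.2 = insert (schedOf st'.1 (f b)) st.2.2) ∨
   (∃ e ∈ st.2.2, e.1 = st'.1 ∧
      st'.2.1 = e.2.2.2.1 ∪ (st.2.1 \ e.2.2.2.2) ∧
      st'.2.2 = st.2.2 \ {e}))

theorem stepAt_iff_step {f : β → DAction α} {P : Set (ℝ × β)} {σ : ℕ → TState α} {i : ℕ} :
    StepAt f P σ i ↔ Step f P (σ (i - 1)) (σ i) := Iff.rfl

/-- The scheduled effects of `st` are those of the actions in progress at its time stamp. -/
def SchedInProgress (f : β → DAction α) (P : Set (ℝ × β)) (st : TState α) : Prop :=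
  ∀ e, e ∈ st.2.2 ↔
    ∃ p ∈ P, p.1 ≤ st.1 ∧ st.1 < p.1 + (f p.2).dur ∧ e = schedOf p.1 (f p.2)

/-- `st` is a possible state of the induced sequence after `k` events. -/
def AfterEvents (f : β → DAction α) (P : Set (ℝ × β)) (k : ℕ) (st : TState α) : Prop :=
  SchedInProgress f P st ∧ (eventTimes f P ∩ Iic st.1).ncard = k

theorem start_mem_eventTimes {f : β → DAction α} {P : Set (ℝ × β)} {p : ℝ × β} (hp : p ∈ P) :
    p.1 ∈ eventTimes f P := Or.inl ⟨p, hp, rfl⟩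

theorem end_mem_eventTimes {f : β → DAction α} {P : Set (ℝ × β)} {p : ℝ × β} (hp : p ∈ P) :
    p.1 + (f p.2).dur ∈ eventTimes f P := Or.inr ⟨p, hp, rfl⟩

namespace IsPlan

variable {f : β → DAction α} {P : Set (ℝ × β)}

theorem eq_of_start_eq_s14 (hP : IsPlan f P) {p q : ℝ × β} (hp : p ∈ P) (hq : q ∈ P)
    (h : p.1 = q.1) : p = q :=
  by_contra fun hne => (hP.2.2 p hp q hq hne).1 h

theorem eq_of_end_eq_s14 (hP : IsPlan f P) {p q : ℝ × β} (hp : p ∈ P) (hq : q ∈ P)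
    (h : p.1 + (f p.2).dur = q.1 + (f q.2).dur) : p = q :=
  by_contra fun hne => (hP.2.2 p hp q hq hne).2.2 h

theorem end_ne_start_s14 (hP : IsPlan f P) (hdur : ∀ p ∈ P, 0 < (f p.2).dur) {p q : ℝ × β}
    (hp : p ∈ P) (hq : q ∈ P) : p.1 + (f p.2).dur ≠ q.1 := by
  by_cases hpq : p = q
  · subst hpq
    have := hdur p hp
    linarith
  · exact (hP.2.2 p hp q hq hpq).2.1

theorem finite_eventTimes (hP : IsPlan f P) : (eventTimes f P).Finite :=
  (hP.1.image _).union (hP.1.image _)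

theorem ncard_eventTimes (hP : IsPlan f P) (hdur : ∀ p ∈ P, 0 < (f p.2).dur) :
    (eventTimes f P).ncard = 2 * P.ncard := by
  rw [eventTimes, ncard_union_eq _ (hP.1.image _) (hP.1.image _),
    InjOn.ncard_image fun p hp q hq h => hP.eq_of_start_eq_s14 hp hq h,
    InjOn.ncard_image fun p hp q hq h => hP.eq_of_end_eq_s14 hp hq h, two_mul]
  rw [Set.disjoint_left]
  rintro _ ⟨p, hp, rfl⟩ ⟨q, hq, h⟩
  exact hP.end_ne_start_s14 hdur hq hp h

theorem eventTimes_pos (hP : IsPlan f P) (hdur : ∀ p ∈ P, 0 < (f p.2).dur) {t : ℝ}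
    (ht : t ∈ eventTimes f P) : 0 < t := by
  rcases ht with ⟨p, hp, rfl⟩ | ⟨p, hp, rfl⟩
  · exact hP.2.1 p hp
  · exact add_pos (hP.2.1 p hp) (hdur p hp)

end IsPlan

theorem SchedInProgress.isLeast_candTimes_iff {f : β → DAction α} {P : Set (ℝ × β)}
    {st : TState α} (hst : SchedInProgress f P st) (hdur : ∀ p ∈ P, 0 < (f p.2).dur) {t : ℝ} :
    IsLeast (candTimes f P st) t ↔ IsLeast (eventTimes f P ∩ Ioi st.1) t := by
  have hsub : candTimes f P st ⊆ eventTimes f P ∩ Ioi st.1 := by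
    rintro t (⟨b, hb, hlt⟩ | ⟨e, he, rfl⟩)
    · exact ⟨start_mem_eventTimes hb, hlt⟩
    · obtain ⟨p, hp, -, hlt, rfl⟩ := (hst e).1 he
      exact ⟨end_mem_eventTimes hp, hlt⟩
  have hle : ∀ t ∈ eventTimes f P ∩ Ioi st.1, ∃ u ∈ candTimes f P st, u ≤ t := by
    rintro _ ⟨⟨p, hp, rfl⟩ | ⟨p, hp, rfl⟩, hlt⟩
    · exact ⟨p.1, Or.inl ⟨p.2, hp, hlt⟩, le_rfl⟩
    · by_cases h : p.1 ≤ st.1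
      · exact ⟨_, Or.inr ⟨_, (hst _).2 ⟨p, hp, h, hlt, rfl⟩, rfl⟩, le_rfl⟩
      · exact ⟨p.1, Or.inl ⟨p.2, hp, not_le.1 h⟩, by
          have := hdur p hp
          simp only
          linarith⟩
  constructor
  · rintro ⟨hmem, hmin⟩
    refine ⟨hsub hmem, fun u hu => ?_⟩
    obtain ⟨v, hv, hvu⟩ := hle u hu
    exact (hmin hv).trans hvu
  · rintro ⟨hmem, hmin⟩
    obtain ⟨v, hv, hvt⟩ := hle t hmem
    obtain rfl : v = t := le_antisymm hvt (hmin (hsub hv))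
    exact ⟨hv, fun u hu => hmin (hsub hu)⟩

theorem Step.isLeast {f : β → DAction α} {P : Set (ℝ × β)} {st st' : TState α}
    (h : Step f P st st') (hst : SchedInProgress f P st) (hdur : ∀ p ∈ P, 0 < (f p.2).dur) :
    IsLeast (eventTimes f P ∩ Ioi st.1) st'.1 :=
  (hst.isLeast_candTimes_iff hdur).1 h.1

theorem Step.schedInProgress {f : β → DAction α} {P : Set (ℝ × β)} {st st' : TState α}
    (h : Step f P st st') (hP : IsPlan f P) (hdur : ∀ p ∈ P, 0 < (f p.2).dur)
    (hst : SchedInProgress f P st) : SchedInProgress f P st' := by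
  obtain ⟨⟨-, hlt⟩, hmin⟩ := h.isLeast hst hdur
  have hlt : st.1 < st'.1 := hlt
  have hstart : ∀ q ∈ P, q.1 ≤ st.1 ∨ st'.1 ≤ q.1 := fun q hq =>
    (le_or_gt q.1 st.1).imp_right fun h => hmin ⟨start_mem_eventTimes hq, h⟩
  have hend : ∀ q ∈ P, st.1 < q.1 + (f q.2).dur → st'.1 ≤ q.1 + (f q.2).dur := fun q hq h =>
    hmin ⟨end_mem_eventTimes hq, h⟩
  intro e
  rcases h.2 with ⟨b, hb, -, hE⟩ | ⟨e', he', het, -, hE⟩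
  · rw [hE, mem_insert_iff, hst]
    constructor
    · rintro (rfl | ⟨p, hp, h1, h2, rfl⟩)
      · exact ⟨_, hb, le_rfl, lt_add_of_pos_right _ (hdur _ hb), rfl⟩
      · exact ⟨p, hp, h1.trans hlt.le,
          (hend p hp h2).lt_of_ne (hP.end_ne_start_s14 hdur hp hb).symm, rfl⟩
    · rintro ⟨p, hp, h1, h2, rfl⟩
      rcases hstart p hp with h | h
      · exact Or.inr ⟨p, hp, h, hlt.trans h2, rfl⟩
      · obtain rfl := hP.eq_of_start_eq_s14 hp hb (le_antisymm h1 h)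
        exact Or.inl rfl
  · obtain ⟨q, hq, -, hq2, rfl⟩ := (hst e').1 he'
    have het : q.1 + (f q.2).dur = st'.1 := het
    rw [hE, mem_sdiff, hst, mem_singleton_iff]
    constructor
    · rintro ⟨⟨p, hp, h1, h2, rfl⟩, hne⟩
      refine ⟨p, hp, h1.trans hlt.le, (hend p hp h2).lt_of_ne fun h => hne ?_, rfl⟩
      rw [hP.eq_of_end_eq_s14 hp hq (h.symm.trans het.symm)]
    · rintro ⟨p, hp, h1, h2, rfl⟩
      refine ⟨⟨p, hp, (hstart p hp).resolve_right fun h => ?_, hlt.trans h2, rfl⟩, fun h => ?_⟩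
      · exact hP.end_ne_start_s14 hdur hq hp (het.trans (le_antisymm h h1))
      · have : p.1 + (f p.2).dur = q.1 + (f q.2).dur := congrArg Prod.fst h
        linarith

theorem Step.afterEvents {f : β → DAction α} {P : Set (ℝ × β)} {st st' : TState α} {k : ℕ}
    (h : Step f P st st') (hP : IsPlan f P) (hdur : ∀ p ∈ P, 0 < (f p.2).dur)
    (hst : AfterEvents f P k st) : AfterEvents f P (k + 1) st' := by
  refine ⟨h.schedInProgress hP hdur hst.1, ?_⟩
  obtain ⟨⟨hT, hlt⟩, hmin⟩ := h.isLeast hst.1 hdur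
  have hlt : st.1 < st'.1 := hlt
  have heq : eventTimes f P ∩ Iic st'.1 = insert st'.1 (eventTimes f P ∩ Iic st.1) := by
    ext t
    simp only [mem_inter_iff, mem_Iic, mem_insert_iff]
    constructor
    · rintro ⟨ht, hle⟩
      rcases le_or_gt t st.1 with h | h
      · exact Or.inr ⟨ht, h⟩
      · exact Or.inl (le_antisymm hle (hmin ⟨ht, h⟩))
    · rintro (rfl | ⟨ht, hle⟩)
      · exact ⟨hT, le_rfl⟩
      · exact ⟨ht, hle.trans hlt.le⟩
  have hnot : st'.1 ∉ eventTimes f P ∩ Iic st.1 := fun hmem => hlt.not_ge hmem.2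
  rw [heq, ncard_insert_of_notMem hnot (hP.finite_eventTimes.inter_of_left _), hst.2]

theorem AfterEvents.exists_step {f : β → DAction α} {P : Set (ℝ × β)} {st : TState α} {k : ℕ}
    (hst : AfterEvents f P k st) (hP : IsPlan f P) (hdur : ∀ p ∈ P, 0 < (f p.2).dur)
    (hk : k < 2 * P.ncard) : ∃ st', Step f P st st' := by
  have hne : (eventTimes f P ∩ Ioi st.1).Nonempty := by
    by_contra hemp
    have hsub : eventTimes f P ∩ Iic st.1 = eventTimes f P :=
      inter_eq_left.2 fun t ht => mem_Iic.2 (not_lt.1 fun hlt => hemp ⟨t, ht, hlt⟩)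
    have := hst.2
    rw [hsub, hP.ncard_eventTimes hdur] at this
    omega
  obtain ⟨t, ht, hmin⟩ :=
    exists_min_image _ id (hP.finite_eventTimes.inter_of_left (Ioi st.1)) hne
  have hleast := (hst.1.isLeast_candTimes_iff hdur).2 ⟨ht, hmin⟩
  rcases hleast.1 with ⟨b, hb, -⟩ | ⟨e, he, het⟩
  · exact ⟨(t, _, insert (schedOf t (f b)) st.2.2), hleast, Or.inl ⟨b, hb, rfl, rfl⟩⟩
  · exact ⟨(t, _, _), hleast, Or.inr ⟨e, he, het, rfl, rfl⟩⟩

theorem afterEvents_zero {f : β → DAction α} {P : Set (ℝ × β)} (s0 : Set α)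
    (hP : IsPlan f P) (hdur : ∀ p ∈ P, 0 < (f p.2).dur) : AfterEvents f P 0 (0, s0, ∅) := by
  constructor
  · intro e
    simp only [mem_empty_iff_false, false_iff]
    rintro ⟨p, hp, hle, -⟩
    exact (hP.2.1 p hp).not_ge hle
  · have : eventTimes f P ∩ Iic (0 : ℝ) = ∅ :=
      eq_empty_of_forall_notMem fun t ht => (hP.eventTimes_pos hdur ht.1).not_ge ht.2
    simp [this]

theorem exists_inducedSeq {f : β → DAction α} {P : Set (ℝ × β)} (s0 : Set α)
    (hP : IsPlan f P) (hdur : ∀ p ∈ P, 0 < (f p.2).dur) : ∃ σ, InducedSeq f P s0 σ := by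
  classical
  let next : TState α → TState α := fun st =>
    if h : ∃ st', Step f P st st' then h.choose else st
  have hnext : ∀ k < 2 * P.ncard, ∀ st, AfterEvents f P k st → Step f P st (next st) := by
    intro k hk st hst
    have h := hst.exists_step hP hdur hk
    simp only [next, dif_pos h]
    exact h.choose_spec
  let σ : ℕ → TState α := fun n => next^[n] (0, s0, ∅)
  have hsucc : ∀ k, σ (k + 1) = next (σ k) := fun k => Function.iterate_succ_apply' _ _ _
  have hσ : ∀ k ≤ 2 * P.ncard, AfterEvents f P k (σ k) := by
    intro k
    induction k with
    | zero => exact fun _ => afterEvents_zero s0 hP hdur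
    | succ k ih =>
      intro hk
      rw [hsucc]
      exact (hnext k hk _ (ih (by omega))).afterEvents hP hdur (ih (by omega))
  refine ⟨σ, rfl, fun i hi hin => ?_⟩
  obtain ⟨k, rfl⟩ := Nat.exists_eq_add_of_le' hi
  rw [stepAt_iff_step, Nat.add_sub_cancel, hsucc]
  exact hnext k hin _ (hσ k (by omega))

namespace InducedSeq

variable {f : β → DAction α} {P : Set (ℝ × β)} {s0 : Set α} {σ : ℕ → TState α}

theorem afterEvents (hσ : InducedSeq f P s0 σ) (hP : IsPlan f P)
    (hdur : ∀ p ∈ P, 0 < (f p.2).dur) {k : ℕ} (hk : k ≤ 2 * P.ncard) :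
    AfterEvents f P k (σ k) := by
  induction k with
  | zero => exact hσ.1 ▸ afterEvents_zero s0 hP hdur
  | succ k ih =>
    exact (stepAt_iff_step.1 (hσ.2 (k + 1) (by omega) hk)).afterEvents hP hdur (ih (by omega))

theorem isLeast (hσ : InducedSeq f P s0 σ) (hP : IsPlan f P)
    (hdur : ∀ p ∈ P, 0 < (f p.2).dur) {i : ℕ} (hi : 1 ≤ i) (hin : i ≤ 2 * P.ncard) :
    IsLeast (eventTimes f P ∩ Ioi (σ (i - 1)).1) (σ i).1 :=
  (stepAt_iff_step.1 (hσ.2 i hi hin)).isLeast (hσ.afterEvents hP hdur (by omega)).1 hdur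

theorem index_eq_of_time_eq (hσ : InducedSeq f P s0 σ) (hP : IsPlan f P)
    (hdur : ∀ p ∈ P, 0 < (f p.2).dur) {i j : ℕ} (hi : i ≤ 2 * P.ncard)
    (hj : j ≤ 2 * P.ncard) (h : (σ i).1 = (σ j).1) : i = j := by
  rw [← (hσ.afterEvents hP hdur hi).2, h, (hσ.afterEvents hP hdur hj).2]

theorem eventTimes_le_last (hσ : InducedSeq f P s0 σ) (hP : IsPlan f P)
    (hdur : ∀ p ∈ P, 0 < (f p.2).dur) {t : ℝ} (ht : t ∈ eventTimes f P) :
    t ≤ (σ (2 * P.ncard)).1 := by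
  have h := eq_of_subset_of_ncard_le (inter_subset_left (t := Iic (σ (2 * P.ncard)).1))
    (by rw [(hσ.afterEvents hP hdur le_rfl).2, hP.ncard_eventTimes hdur]) hP.finite_eventTimes
  exact (h.symm ▸ ht : t ∈ eventTimes f P ∩ Iic _).2

theorem exists_index_s14 (hσ : InducedSeq f P s0 σ) (hP : IsPlan f P)
    (hdur : ∀ p ∈ P, 0 < (f p.2).dur) {t : ℝ} (ht : t ∈ eventTimes f P) :
    ∃ i, 1 ≤ i ∧ i ≤ 2 * P.ncard ∧ (σ i).1 = t := by
  classical
  have hex : ∃ i, t ≤ (σ i).1 := ⟨_, hσ.eventTimes_le_last hP hdur ht⟩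
  have hle : Nat.find hex ≤ 2 * P.ncard := Nat.find_min' hex (hσ.eventTimes_le_last hP hdur ht)
  have hpos : 1 ≤ Nat.find hex := by
    rw [Nat.one_le_iff_ne_zero]
    intro h0
    have h := Nat.find_spec hex
    rw [h0, hσ.1] at h
    exact (hP.eventTimes_pos hdur ht).not_ge h
  have hlt : (σ (Nat.find hex - 1)).1 < t := not_le.1 (Nat.find_min hex (by omega))
  exact ⟨_, hpos, hle, le_antisymm ((hσ.isLeast hP hdur hpos hle).2 ⟨ht, hlt⟩)
    (Nat.find_spec hex)⟩

theorem start_or_end (hσ : InducedSeq f P s0 σ) (hP : IsPlan f P)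
    (hdur : ∀ p ∈ P, 0 < (f p.2).dur) {i : ℕ} (hi : 1 ≤ i) (hin : i ≤ 2 * P.ncard) :
    ((∃! b, ((σ i).1, b) ∈ P) ∧ ¬∃ e ∈ (σ (i - 1)).2.2, e.1 = (σ i).1) ∨
      ((∃! e, e ∈ (σ (i - 1)).2.2 ∧ e.1 = (σ i).1) ∧ ¬∃ b, ((σ i).1, b) ∈ P) := by
  have hE := (hσ.afterEvents hP hdur (k := i - 1) (by omega)).1
  rcases (hσ.2 i hi hin).1.1 with ⟨b, hb, -⟩ | ⟨e, he, het⟩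
  · refine Or.inl ⟨⟨b, hb, fun c hc => congrArg Prod.snd (hP.eq_of_start_eq_s14 hc hb rfl)⟩, ?_⟩
    rintro ⟨e, he, het⟩
    obtain ⟨p, hp, -, -, rfl⟩ := (hE e).1 he
    exact hP.end_ne_start_s14 hdur hp hb het
  · obtain ⟨p, hp, -, -, rfl⟩ := (hE e).1 he
    refine Or.inr ⟨⟨_, ⟨he, het⟩, ?_⟩, ?_⟩
    · rintro e' ⟨he', het'⟩
      obtain ⟨q, hq, -, -, rfl⟩ := (hE e').1 he'
      rw [hP.eq_of_end_eq_s14 hq hp (het'.trans het.symm)]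
    · rintro ⟨b, hb⟩
      exact hP.end_ne_start_s14 hdur hp hb het

theorem endTuple_mem (hσ : InducedSeq f P s0 σ) (hP : IsPlan f P)
    (hdur : ∀ p ∈ P, 0 < (f p.2).dur) {i : ℕ} (hi : 1 ≤ i) (hin : i ≤ 2 * P.ncard)
    {p : ℝ × β} (hp : p ∈ P) (h : (σ i).1 = p.1 + (f p.2).dur) :
    endTuple (σ i).1 (f p.2) ∈ (σ (i - 1)).2.2 := by
  obtain ⟨⟨-, hlt⟩, hmin⟩ := hσ.isLeast hP hdur hi hin
  refine ((hσ.afterEvents hP hdur (by omega)).1 _).2 ⟨p, hp, not_lt.1 fun hgt => ?_, h ▸ hlt, ?_⟩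
  · have := hmin ⟨start_mem_eventTimes hp, hgt⟩
    have := hdur p hp
    linarith
  · rw [h]
    rfl

theorem last_sched_eq_empty (hσ : InducedSeq f P s0 σ) (hP : IsPlan f P)
    (hdur : ∀ p ∈ P, 0 < (f p.2).dur) : (σ (2 * P.ncard)).2.2 = ∅ := by
  refine eq_empty_of_forall_notMem fun e he => ?_
  obtain ⟨p, hp, -, hlt, -⟩ := ((hσ.afterEvents hP hdur le_rfl).1 e).1 he
  exact hlt.not_ge (hσ.eventTimes_le_last hP hdur (end_mem_eventTimes hp))

end InducedSeq

end InducedSequence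

/-- Well-definedness of the induced sequence of time-stamped states of a plan:
the candidate set at each step is nonempty (so its minimum exists), exactly one
of the two update cases applies at each position (a unique starting event or a
unique ending event, but not both), each time-stamped action gives rise to
exactly one starting and one ending event, and all scheduled effects are
consumed at the end. -/
theorem induced_seq_well_defined {α β : Type*} (f : β → DAction α)
    (P : Set (ℝ × β)) (s0 : Set α)
    (hP : IsPlan f P) (hWF : ∀ p ∈ P, (f p.2).WF) :
    (∃ σ, InducedSeq f P s0 σ) ∧
    ∀ σ, InducedSeq f P s0 σ →
      (∀ i, 1 ≤ i → i ≤ 2 * P.ncard → (candTimes f P (σ (i - 1))).Nonempty) ∧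
      (∀ i, 1 ≤ i → i ≤ 2 * P.ncard →
        (((∃! b, ((σ i).1, b) ∈ P) ∧ ¬∃ e ∈ (σ (i - 1)).2.2, e.1 = (σ i).1) ∨
         ((∃! e, e ∈ (σ (i - 1)).2.2 ∧ e.1 = (σ i).1) ∧
           ¬∃ b, ((σ i).1, b) ∈ P))) ∧
      (∀ p ∈ P,
        (∃! i, 1 ≤ i ∧ i ≤ 2 * P.ncard ∧ (σ i).1 = p.1) ∧
        (∃! i, 1 ≤ i ∧ i ≤ 2 * P.ncard ∧ (σ i).1 = p.1 + (f p.2).dur ∧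
          endTuple ((σ i).1) (f p.2) ∈ (σ (i - 1)).2.2)) ∧
      (σ (2 * P.ncard)).2.2 = ∅ := by
  have hdur : ∀ p ∈ P, 0 < (f p.2).dur := fun p hp => (hWF p hp).1
  refine ⟨exists_inducedSeq s0 hP hdur, fun σ hσ => ⟨fun i hi hin => ⟨_, (hσ.2 i hi hin).1.1⟩,
    fun i hi hin => hσ.start_or_end hP hdur hi hin, fun p hp => ⟨?_, ?_⟩,
    hσ.last_sched_eq_empty hP hdur⟩⟩
  · obtain ⟨i, hi, hin, h⟩ := hσ.exists_index_s14 hP hdur (start_mem_eventTimes hp)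
    exact ⟨i, ⟨hi, hin, h⟩, fun j hj =>
      hσ.index_eq_of_time_eq hP hdur hj.2.1 hin (hj.2.2.trans h.symm)⟩
  · obtain ⟨i, hi, hin, h⟩ := hσ.exists_index_s14 hP hdur (end_mem_eventTimes hp)
    exact ⟨i, ⟨hi, hin, h, hσ.endTuple_mem hP hdur hi hin hp h⟩, fun j hj =>
      hσ.index_eq_of_time_eq hP hdur hj.2.1 hin (hj.2.2.1.trans h.symm)⟩
end
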